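/- Let (R, m) be a local ring of finite embedding dimension and let I be a closed ideal of R. Then I has only finitely many minimal primes (prime ideals minimal over I), and each minimal prime of I is itself a closed ideal. -/

import Mathlib

/-!
STATEMENT 3: In a local ring `(R, m)` of finite embedding dimension, a closed ideal `I`
(i.e. `I = ⋂ₙ (I + m^n)`) has only finitely many minimal primes, and each minimal prime
of `I` is itself closed.
-/

universe u

namespace Ideal

variable {R : Type u} [CommRing R] (m : Ideal R)

/-- The closure of an ideal in the `m`-adic topology. -/
def adicClosure (J : Ideal R) : Ideal R := ⨅ n : ℕ, J + m ^ n

variable {m}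

theorem mem_adicClosure {J : Ideal R} {x : R} :
    x ∈ adicClosure m J ↔ ∀ n : ℕ, x ∈ J + m ^ n := by
  simp [adicClosure, Submodule.mem_iInf]

theorem le_adicClosure (J : Ideal R) : J ≤ adicClosure m J :=
  le_iInf fun _ => le_sup_left

theorem adicClosure_adicClosure (J : Ideal R) :
    adicClosure m (adicClosure m J) = adicClosure m J := by
  refine le_antisymm (le_iInf fun n => (iInf_le _ n).trans ?_) (le_adicClosure _)
  exact sup_le (iInf_le _ n) le_sup_right

theorem adicClosure_mul_adicClosure_le (J K : Ideal R) :
    adicClosure m J * adicClosure m K ≤ adicClosure m (J * K) := by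
  refine le_iInf fun n => (mul_mono (iInf_le _ n) (iInf_le _ n)).trans ?_
  rw [add_eq_sup, add_eq_sup, add_eq_sup, sup_mul, mul_sup]
  exact sup_le (sup_le le_sup_left (Ideal.mul_le_right.trans le_sup_right))
    (Ideal.mul_le_left.trans le_sup_right)

theorem adicClosure_mono {J K : Ideal R} (h : J ≤ K) : adicClosure m J ≤ adicClosure m K :=
  iInf_mono fun _ => sup_le_sup_right h _

variable (m) in
/-- The preimage in the Rees algebra of the initial ideal of `J` in the associated graded ring. -/
def initialIdeal (J : Ideal R) : Ideal (reesAlgebra m) where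
  carrier := {f | ∀ d, (f : Polynomial R).coeff d ∈ J ⊔ m ^ (d + 1)}
  zero_mem' d := by simp
  add_mem' hf hg d := by
    simpa using add_mem (hf d) (hg d)
  smul_mem' g f hf d := by
    have key : ((g : Polynomial R) * (f : Polynomial R)).coeff d ∈ J ⊔ m ^ (d + 1) := by
      rw [Polynomial.coeff_mul]
      refine _root_.sum_mem fun ij hij => ?_
      obtain rfl := Finset.HasAntidiagonal.mem_antidiagonal.mp hij
      have h := mul_mem_mul (g.2 ij.1) (hf ij.2)
      rw [mul_sup, ← pow_add, ← add_assoc] at h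
      exact sup_le_sup_right (Ideal.mul_le_right (I := m ^ ij.1) (J := J)) _ h
    simpa using key

theorem mem_initialIdeal {J : Ideal R} {f : reesAlgebra m} :
    f ∈ initialIdeal m J ↔ ∀ d, (f : Polynomial R).coeff d ∈ J ⊔ m ^ (d + 1) := Iff.rfl

theorem initialIdeal_mono {J K : Ideal R} (h : J ≤ K) : initialIdeal m J ≤ initialIdeal m K :=
  fun _ hf d => sup_le_sup_right h _ (hf d)

theorem map_algebraMap_le_initialIdeal (J : Ideal R) :
    m.map (algebraMap R (reesAlgebra m)) ≤ initialIdeal m J := by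
  refine map_le_iff_le_comap.mpr fun r hr => ?_
  rw [mem_comap, mem_initialIdeal]
  intro d
  change (Polynomial.C r).coeff d ∈ _
  rw [Polynomial.coeff_C]
  split_ifs with h
  · subst h
    exact mem_sup_right (by simpa using hr)
  · exact zero_mem _

theorem le_adicClosure_of_initialIdeal_le {J K : Ideal R} (hJK : J ≤ K)
    (h : initialIdeal m K ≤ initialIdeal m J) : K ≤ adicClosure m J := by
  refine le_iInf fun n => ?_
  induction n with
  | zero => simp
  | succ d ih =>
    intro z hz
    obtain ⟨y, hy, w, hw, rfl⟩ := Submodule.mem_sup.mp (ih hz)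
    have hwK : w ∈ K := (K.add_mem_iff_right (hJK hy)).mp hz
    have hmem : (⟨Polynomial.monomial d w, reesAlgebra.monomial_mem.mpr hw⟩ : reesAlgebra m) ∈
        initialIdeal m K := by
      intro e
      rw [Polynomial.coeff_monomial]
      split_ifs
      · exact mem_sup_left hwK
      · exact zero_mem _
    have hwJ := h hmem d
    rw [Polynomial.coeff_monomial, if_pos rfl] at hwJ
    exact add_mem (mem_sup_left hy) hwJ

theorem isNoetherianRing_reesAlgebra_quotient [IsNoetherianRing (R ⧸ m)] (hm : m.FG) :
    IsNoetherianRing (reesAlgebra m ⧸ m.map (algebraMap R (reesAlgebra m))) := by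
  have : Algebra.FiniteType R (reesAlgebra m) :=
    (reesAlgebra m).fg_iff_finiteType.mp (reesAlgebra.fg hm)
  have : Algebra.FiniteType R (reesAlgebra m ⧸ m.map (algebraMap R (reesAlgebra m))) :=
    .trans this inferInstance
  have : Algebra.FiniteType (R ⧸ m) (reesAlgebra m ⧸ m.map (algebraMap R (reesAlgebra m))) :=
    .of_restrictScalars_finiteType R (R ⧸ m) _
  exact Algebra.FiniteType.isNoetherianRing (R ⧸ m)
    (reesAlgebra m ⧸ m.map (algebraMap R (reesAlgebra m)))

theorem wellFoundedGT_adicClosed [IsNoetherianRing (R ⧸ m)] (hm : m.FG) :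
    WellFoundedGT {J : Ideal R // adicClosure m J = J} := by
  have := isNoetherianRing_reesAlgebra_quotient hm
  let q := Quotient.mk (m.map (algebraMap R (reesAlgebra m)))
  let φ : {J : Ideal R // adicClosure m J = J} →
    Ideal (reesAlgebra m ⧸ m.map (algebraMap R (reesAlgebra m))) :=
    fun J => (initialIdeal m J.1).map q
  have hcomap (J : Ideal R) : ((initialIdeal m J).map q).comap q = initialIdeal m J := by
    rw [comap_map_of_surjective' q Quotient.mk_surjective, mk_ker,
      sup_eq_left.mpr (map_algebraMap_le_initialIdeal J)]
  have hφ : StrictMono φ := fun J K hJK => by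
    refine lt_of_le_not_ge (map_mono (initialIdeal_mono hJK.le)) fun h => hJK.not_ge ?_
    have h' := comap_mono (f := q) h
    rw [hcomap, hcomap] at h'
    exact (le_adicClosure_of_initialIdeal_le hJK.le h').trans J.2.le
  exact hφ.wellFoundedGT

theorem exists_multiset_prod_le_of_adicClosed [IsNoetherianRing (R ⧸ m)] (hm : m.FG)
    (I : Ideal R) (hI : adicClosure m I = I) :
    ∃ s : Multiset (Ideal R),
      (∀ P ∈ s, P.IsPrime ∧ I ≤ P ∧ adicClosure m P = P) ∧ s.prod ≤ I := by
  have := wellFoundedGT_adicClosed hm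
  suffices ∀ J : {J : Ideal R // adicClosure m J = J}, ∃ s : Multiset (Ideal R),
      (∀ P ∈ s, P.IsPrime ∧ J.1 ≤ P ∧ adicClosure m P = P) ∧ s.prod ≤ J.1 from this ⟨I, hI⟩
  intro J
  induction J using WellFoundedGT.induction with
  | ind J ih =>
    obtain ⟨J, hJ⟩ := J
    by_cases htop : J = ⊤
    · exact ⟨0, by simp, by simp [htop]⟩
    by_cases hp : J.IsPrime
    · exact ⟨{J}, by simp [hp, hJ], by simp⟩
    obtain ⟨a, ha, b, hb, hab⟩ := (not_isPrime_iff.mp hp).resolve_left htop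
    have step (c : R) (hc : c ∉ J) : ∃ s : Multiset (Ideal R),
        (∀ P ∈ s, P.IsPrime ∧ J ≤ P ∧ adicClosure m P = P) ∧
          s.prod ≤ adicClosure m (J ⊔ span {c}) := by
      have hle : J ≤ adicClosure m (J ⊔ span {c}) := le_sup_left.trans (le_adicClosure _)
      obtain ⟨s, hs, hsp⟩ := ih ⟨_, adicClosure_adicClosure (J ⊔ span {c})⟩
        (lt_of_le_not_ge hle fun h => hc <| h <| le_adicClosure _ <|
          mem_sup_right (mem_span_singleton_self c))
      exact ⟨s, fun P hP => ⟨(hs P hP).1, hle.trans (hs P hP).2.1, (hs P hP).2.2⟩, hsp⟩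
    obtain ⟨s, hs, hsp⟩ := step a ha
    obtain ⟨t, ht, htp⟩ := step b hb
    refine ⟨s + t, fun P hP => (Multiset.mem_add.mp hP).elim (hs P) (ht P), ?_⟩
    rw [Multiset.prod_add]
    refine (mul_mono hsp htp).trans <| (adicClosure_mul_adicClosure_le _ _).trans <|
      (adicClosure_mono ?_).trans hJ.le
    rw [sup_mul, mul_sup (span {a}), span_singleton_mul_span_singleton]
    exact sup_le Ideal.mul_le_left
      (sup_le Ideal.mul_le_right ((span_singleton_le_iff_mem _).mpr hab))

end Ideal

theorem closed_ideal_finitely_many_minimal_primes_and_closed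
    (R : Type u) [CommRing R] [IsLocalRing R]
    (hfg : (IsLocalRing.maximalIdeal R).FG)
    (I : Ideal R) (hclosed : I = ⨅ n : ℕ, I + IsLocalRing.maximalIdeal R ^ n) :
    I.minimalPrimes.Finite ∧
      ∀ p ∈ I.minimalPrimes, p = ⨅ n : ℕ, p + IsLocalRing.maximalIdeal R ^ n := by
  have : IsNoetherianRing (R ⧸ IsLocalRing.maximalIdeal R) :=
    inferInstanceAs (IsNoetherianRing (IsLocalRing.ResidueField R))
  obtain ⟨s, hs, hsI⟩ := Ideal.exists_multiset_prod_le_of_adicClosed hfg I hclosed.symm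
  have hmem : ∀ p ∈ I.minimalPrimes, p ∈ s := fun p hp => by
    obtain ⟨P, hP, hPp⟩ := (hp.1.1.multiset_prod_le).mp (hsI.trans hp.1.2)
    rwa [← le_antisymm hPp (hp.2 ⟨(hs P hP).1, (hs P hP).2.1⟩ hPp)]
  classical
  exact ⟨s.toFinset.finite_toSet.subset fun p hp => by simpa using hmem p hp,
    fun p hp => (hs p (hmem p hp)).2.2.symm⟩
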